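/- The function $\Phi$ is continuous at $0$: as $s \to 0$ with $s \ne 0$, $\Phi(s) \to \Phi(0) = \frac{32}{3\pi^2}$. Equivalently, $\lim_{s\to 0^+} s\big((s^2+1)E(1-1/s^2) - 2K(1-1/s^2)\big) = 1$. -/

import Mathlib

open MeasureTheory Filter

/-- Complete elliptic integral of the second kind, `E(k) = ∫₀¹ √(1-kt²)/√(1-t²) dt`. -/
noncomputable def ellipticE (k : ℝ) : ℝ :=
  ∫ t in (0:ℝ)..1, Real.sqrt (1 - k * t ^ 2) / Real.sqrt (1 - t ^ 2)

/-- Complete elliptic integral of the first kind, `K(k) = ∫₀¹ dt/√((1-t²)(1-kt²))`. -/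
noncomputable def ellipticK (k : ℝ) : ℝ :=
  ∫ t in (0:ℝ)..1, 1 / Real.sqrt ((1 - t ^ 2) * (1 - k * t ^ 2))

/-- The Sato–Tate trace density `Φ`. -/
noncomputable def Phi (s : ℝ) : ℝ :=
  if s = 0 then 32 / (3 * Real.pi ^ 2)
  else 32 * |s| / (3 * Real.pi ^ 2) *
    ((s ^ 2 + 1) * ellipticE (1 - 1 / s ^ 2) - 2 * ellipticK (1 - 1 / s ^ 2))

lemma intervalIntegrable_one_div_sqrt_one_sub_sq :
    IntervalIntegrable (fun t : ℝ => 1 / Real.sqrt (1 - t ^ 2)) volume 0 1 := by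
  refine intervalIntegral.intervalIntegrable_deriv_of_nonneg (g := Real.arcsin)
    Real.continuous_arcsin.continuousOn (fun t ht => ?_) (fun t _ => by positivity)
  simp only [min_eq_left zero_le_one, max_eq_right zero_le_one, Set.mem_Ioo] at ht
  exact Real.hasDerivAt_arcsin (by linarith) (by linarith)

lemma integral_div_sqrt_one_sub_sq :
    ∫ t in (0:ℝ)..1, t / Real.sqrt (1 - t ^ 2) = 1 := by
  have hderiv : ∀ t ∈ Set.Ioo (0:ℝ) 1,
      HasDerivAt (fun t : ℝ => -Real.sqrt (1 - t ^ 2)) (t / Real.sqrt (1 - t ^ 2)) t := by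
    intro t ht
    have hpos : 0 < 1 - t ^ 2 := by nlinarith [ht.1, ht.2]
    have h := (((hasDerivAt_pow 2 t).const_sub 1).sqrt hpos.ne').neg
    refine h.congr_deriv ?_
    have := (Real.sqrt_pos.2 hpos).ne'
    field_simp
    norm_num
  have hcont : ContinuousOn (fun t : ℝ => -Real.sqrt (1 - t ^ 2)) (Set.Icc 0 1) := by fun_prop
  have hint : IntervalIntegrable (fun t : ℝ => t / Real.sqrt (1 - t ^ 2)) volume 0 1 := by
    simpa only [mul_one_div, id] using
      intervalIntegrable_one_div_sqrt_one_sub_sq.continuousOn_mul continuous_id.continuousOn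
  rw [intervalIntegral.integral_eq_sub_of_hasDerivAt_of_le zero_le_one hcont hderiv hint]
  norm_num

lemma mul_ellipticE_one_sub_inv_sq {s : ℝ} (hs : 0 < s) :
    s * ellipticE (1 - 1 / s ^ 2) =
      ∫ t in (0:ℝ)..1, Real.sqrt (s ^ 2 + (1 - s ^ 2) * t ^ 2) / Real.sqrt (1 - t ^ 2) := by
  rw [ellipticE, ← intervalIntegral.integral_const_mul]
  congr 1 with t
  have h : s ^ 2 + (1 - s ^ 2) * t ^ 2 = s ^ 2 * (1 - (1 - 1 / s ^ 2) * t ^ 2) := by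
    field_simp
    ring
  rw [h, Real.sqrt_mul (sq_nonneg s), Real.sqrt_sq hs.le, mul_div_assoc]

lemma tendsto_mul_ellipticE :
    Tendsto (fun s : ℝ => s * ellipticE (1 - 1 / s ^ 2)) (nhdsWithin 0 (Set.Ioi 0)) (nhds 1) := by
  have hlim : Tendsto
      (fun s : ℝ => ∫ t in (0:ℝ)..1,
        Real.sqrt (s ^ 2 + (1 - s ^ 2) * t ^ 2) / Real.sqrt (1 - t ^ 2))
      (nhdsWithin 0 (Set.Ioi 0)) (nhds (∫ t in (0:ℝ)..1, t / Real.sqrt (1 - t ^ 2))) := by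
    refine intervalIntegral.tendsto_integral_filter_of_dominated_convergence
      (fun t => 1 / Real.sqrt (1 - t ^ 2)) (Eventually.of_forall fun s => ?_) ?_
      intervalIntegrable_one_div_sqrt_one_sub_sq (Eventually.of_forall fun t ht => ?_)
    · exact Measurable.aestronglyMeasurable (by fun_prop)
    · filter_upwards [Ioo_mem_nhdsGT (zero_lt_one (α := ℝ))] with s hs
      refine Eventually.of_forall fun t ht => ?_
      rw [Set.uIoc_of_le zero_le_one] at ht
      rw [Real.norm_of_nonneg (by positivity)]
      gcongr
      rw [Real.sqrt_le_one]
      have hs1 : 0 ≤ 1 - s ^ 2 := by nlinarith [hs.1, hs.2]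
      have ht1 : 0 ≤ 1 - t ^ 2 := by nlinarith [ht.1, ht.2]
      nlinarith [mul_nonneg hs1 ht1]
    · rw [Set.uIoc_of_le zero_le_one] at ht
      have hcont : Continuous fun s : ℝ =>
          Real.sqrt (s ^ 2 + (1 - s ^ 2) * t ^ 2) / Real.sqrt (1 - t ^ 2) := by fun_prop
      have h := hcont.tendsto 0
      norm_num [Real.sqrt_sq ht.1.le] at h
      exact h.mono_left nhdsWithin_le_nhds
  rw [integral_div_sqrt_one_sub_sq] at hlim
  refine hlim.congr' ?_
  filter_upwards [self_mem_nhdsWithin] with s hs using (mul_ellipticE_one_sub_inv_sq hs).symm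

lemma ellipticK_nonneg (k : ℝ) : 0 ≤ ellipticK k :=
  intervalIntegral.integral_nonneg zero_le_one fun _ _ => by positivity

lemma ellipticK_le_of_nonpos {k : ℝ} (hk : k ≤ 0) :
    ellipticK k ≤ ∫ t in (0:ℝ)..1, 1 / Real.sqrt (1 - t ^ 2) := by
  have hle : ∀ t ∈ Set.Ioo (0:ℝ) 1,
      1 / Real.sqrt ((1 - t ^ 2) * (1 - k * t ^ 2)) ≤ 1 / Real.sqrt (1 - t ^ 2) := by
    intro t ht
    have hpos : 0 < 1 - t ^ 2 := by nlinarith [ht.1, ht.2]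
    have hkt : 0 ≤ -k * t ^ 2 := by have := neg_nonneg.2 hk; positivity
    have := Real.sqrt_pos.2 hpos
    gcongr
    exact le_mul_of_one_le_right hpos.le (by linarith)
  rw [ellipticK, intervalIntegral.integral_of_le zero_le_one,
    intervalIntegral.integral_of_le zero_le_one, integral_Ioc_eq_integral_Ioo,
    integral_Ioc_eq_integral_Ioo]
  refine integral_mono_of_nonneg (Eventually.of_forall fun t => by positivity) ?_
    ((ae_restrict_iff' measurableSet_Ioo).2 (Eventually.of_forall hle))
  exact ((intervalIntegrable_iff_integrableOn_Ioo_of_le zero_le_one).1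
    intervalIntegrable_one_div_sqrt_one_sub_sq)

lemma tendsto_mul_ellipticK :
    Tendsto (fun s : ℝ => s * ellipticK (1 - 1 / s ^ 2)) (nhdsWithin 0 (Set.Ioi 0)) (nhds 0) := by
  have hid : Tendsto (fun s : ℝ => s) (nhdsWithin 0 (Set.Ioi 0)) (nhds 0) :=
    tendsto_id.mono_left nhdsWithin_le_nhds
  have hub := hid.mul_const (∫ t in (0:ℝ)..1, 1 / Real.sqrt (1 - t ^ 2))
  rw [zero_mul] at hub
  refine tendsto_of_tendsto_of_tendsto_of_le_of_le' tendsto_const_nhds hub ?_ ?_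
  · filter_upwards [self_mem_nhdsWithin] with s hs
    exact mul_nonneg (le_of_lt hs) (ellipticK_nonneg _)
  · filter_upwards [Ioo_mem_nhdsGT (zero_lt_one (α := ℝ))] with s hs
    refine mul_le_mul_of_nonneg_left (ellipticK_le_of_nonpos ?_) hs.1.le
    rw [sub_nonpos]
    exact one_le_one_div (pow_pos hs.1 2) (pow_le_one₀ hs.1.le hs.2.le)

lemma tendsto_elliptic_combination :
    Tendsto
      (fun s : ℝ =>
        s * ((s ^ 2 + 1) * ellipticE (1 - 1 / s ^ 2) - 2 * ellipticK (1 - 1 / s ^ 2)))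
      (nhdsWithin 0 (Set.Ioi 0)) (nhds 1) := by
  have hsq : Tendsto (fun s : ℝ => s ^ 2 + 1) (nhdsWithin 0 (Set.Ioi 0)) (nhds 1) := by
    have hcont : Continuous fun s : ℝ => s ^ 2 + 1 := by fun_prop
    simpa using (hcont.tendsto 0).mono_left nhdsWithin_le_nhds
  have h := (hsq.mul tendsto_mul_ellipticE).sub (tendsto_mul_ellipticK.const_mul 2)
  rw [mul_one, mul_zero, sub_zero] at h
  exact h.congr fun s => by ring

/-- `Φ` is continuous at `0`, `Φ(0) = 32/(3π²)`, and equivalently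
`lim_{s→0⁺} s((s²+1)E(1-1/s²) - 2K(1-1/s²)) = 1`. -/
theorem phi_continuousAt_zero :
    ContinuousAt Phi 0 ∧ Phi 0 = 32 / (3 * Real.pi ^ 2) ∧
      Tendsto
        (fun s : ℝ =>
          s * ((s ^ 2 + 1) * ellipticE (1 - 1 / s ^ 2) - 2 * ellipticK (1 - 1 / s ^ 2)))
        (nhdsWithin 0 (Set.Ioi 0)) (nhds 1) := by
  refine ⟨?_, by simp [Phi], tendsto_elliptic_combination⟩
  rw [continuousAt_iff_punctured_nhds]
  have habs : Tendsto (fun s : ℝ => |s|) (nhdsWithin 0 {0}ᶜ) (nhdsWithin 0 (Set.Ioi 0)) :=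
    tendsto_abs_nhdsNE_zero
  have h := (tendsto_elliptic_combination.comp habs).const_mul (32 / (3 * Real.pi ^ 2))
  have hzero : Phi 0 = 32 / (3 * Real.pi ^ 2) * 1 := by simp [Phi]
  rw [hzero]
  refine h.congr' ?_
  filter_upwards [self_mem_nhdsWithin] with s hs
  simp only [Function.comp, sq_abs, Phi, if_neg (show s ≠ 0 from hs)]
  ring
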